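/- Suppose F has characteristic p ≥ 5, let q be a power of p, and let t_1 ∈ F^× have multiplicative order q − 1. Set t = diag(t_1, 1, t_1^{-1}) and let h be the corresponding endomorphism of sl_3(F). Then h has simple spectrum on sl_3(F), i.e., h has eight pairwise distinct eigenvalues. -/

import Mathlib

noncomputable section

/-- `sl₃(F)`: the space of traceless `3 × 3` matrices over `F`. -/
def sl3 (F : Type*) [Field F] : Submodule F (Matrix (Fin 3) (Fin 3) F) :=
  LinearMap.ker (Matrix.traceLinearMap (Fin 3) F F)

/-- The matrix `n_w` with rows `(0,1,0)`, `(1,0,0)`, `(0,0,-1)`. -/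
def nw (F : Type*) [Field F] : Matrix (Fin 3) (Fin 3) F :=
  !![0, 1, 0; 1, 0, 0; 0, 0, -1]

/-- The endomorphism `X ↦ -((n_w t) X (n_w t)⁻¹)ᵀ` of the space of `3 × 3` matrices,
where `t = diag(t₁, t₂, t₃)`. -/
def hFull (F : Type*) [Field F] (t₁ t₂ t₃ : F) :
    Module.End F (Matrix (Fin 3) (Fin 3) F) :=
  -((Matrix.transposeLinearEquiv (Fin 3) (Fin 3) F F).toLinearMap
      ∘ₗ LinearMap.mulRight F (nw F * Matrix.diagonal ![t₁, t₂, t₃])⁻¹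
      ∘ₗ LinearMap.mulLeft F (nw F * Matrix.diagonal ![t₁, t₂, t₃]))

/-- A diagonalizable endomorphism has *simple spectrum* if it is diagonalizable and every
eigenvalue has (geometric) multiplicity 1. -/
def HasSimpleSpectrum {F V : Type*} [Field F] [AddCommGroup V] [Module F V]
    (f : Module.End F V) : Prop :=
  (⨆ μ : F, f.eigenspace μ) = ⊤ ∧ ∀ μ : F, Module.finrank F (f.eigenspace μ) ≤ 1

open Module in
/-- An endomorphism with `dim V` distinct eigenvalues has simple spectrum. -/
theorem HasSimpleSpectrum.of_injective {F V ι : Type*} [Field F] [AddCommGroup V] [Module F V]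
    [FiniteDimensional F V] [Fintype ι] {f : End F V} {μ : ι → F} (hμ : Function.Injective μ)
    {v : ι → V} (hv : ∀ i, f.HasEigenvector (μ i) (v i)) (hcard : Fintype.card ι = finrank F V) :
    HasSimpleSpectrum f := by
  classical
  have hli : LinearIndependent F v := End.eigenvectors_linearIndependent' f μ hμ v hv
  have hspan : Submodule.span F (Set.range v) = ⊤ := hli.span_eq_top_of_card_eq_finrank' hcard
  let b : Basis ι F V := Basis.mk hli hspan.ge
  have hb (i : ι) : b i = v i := Basis.mk_apply hli hspan.ge i
  refine ⟨eq_top_iff.2 ?_, fun c => ?_⟩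
  · rw [← hspan, Submodule.span_le]
    rintro _ ⟨i, rfl⟩
    exact (le_iSup f.eigenspace (μ i)) (hv i).1
  have hcoord (x : V) (hx : x ∈ f.eigenspace c) (i : ι) (hi : μ i ≠ c) : b.repr x i = 0 := by
    have hfx : f x = ∑ j, (b.repr x j * μ j) • b j := by
      conv_lhs => rw [← b.sum_repr x, map_sum]
      refine Finset.sum_congr rfl fun j _ => ?_
      rw [map_smul, hb, (hv j).apply_eq_smul, smul_smul]
    have hi' : b.repr (f x) i = b.repr x i * μ i := by rw [hfx, b.repr_sum_self]
    rw [End.mem_eigenspace_iff.1 hx, map_smul, Finsupp.smul_apply, smul_eq_mul] at hi'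
    have : (μ i - c) * b.repr x i = 0 := by linear_combination -hi'
    exact (mul_eq_zero.1 this).resolve_left (sub_ne_zero.2 hi)
  by_cases hc : ∃ i, μ i = c
  · obtain ⟨i, rfl⟩ := hc
    refine finrank_le_one ⟨v i, (hv i).1⟩ fun x => ⟨b.repr x i, Subtype.ext ?_⟩
    change b.repr x i • v i = x
    conv_rhs => rw [← b.sum_repr x]
    rw [Finset.sum_eq_single_of_mem i (Finset.mem_univ i), hb]
    intro j _ hj
    rw [hcoord x x.2 j (hμ.ne hj), zero_smul]
  · push Not at hc
    have : f.eigenspace c = ⊥ := (Submodule.eq_bot_iff _).2 fun x hx =>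
      b.ext_elem fun i => by rw [hcoord x hx i (hc i), map_zero, Finsupp.zero_apply]
    rw [this, finrank_bot]
    exact zero_le_one

theorem finrank_sl3 (F : Type*) [Field F] : Module.finrank F (sl3 F) = 8 := by
  have hne : Matrix.traceLinearMap (Fin 3) F F ≠ 0 := fun h => by
    simpa using LinearMap.congr_fun h (Matrix.single 0 0 1)
  have := Module.Dual.finrank_ker_add_one_of_ne_zero (f := Matrix.traceLinearMap (Fin 3) F F) hne
  rw [Module.finrank_matrix, Module.finrank_self, Fintype.card_fin] at this
  exact Nat.succ_injective this

theorem hFull_apply {F : Type*} [Field F] {a b : F} (hab : a * b = 1)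
    (X : Matrix (Fin 3) (Fin 3) F) :
    hFull F a 1 b X =
      !![-X 1 1, -(a * X 0 1), b * X 2 1;
         -(b * X 1 0), -X 0 0, b ^ 2 * X 2 0;
         a * X 1 2, a ^ 2 * X 0 2, -X 2 2] := by
  have hN : nw F * Matrix.diagonal ![a, 1, b] = !![0, 1, 0; a, 0, 0; 0, 0, -b] := by
    ext i j
    fin_cases i <;> fin_cases j <;> simp [nw]
  have hinv : (!![0, 1, 0; a, 0, 0; 0, 0, -b] : Matrix (Fin 3) (Fin 3) F)⁻¹ =
      !![0, b, 0; 1, 0, 0; 0, 0, -a] := by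
    refine Matrix.inv_eq_right_inv ?_
    ext i j
    fin_cases i <;> fin_cases j <;> simp [Matrix.mul_apply, Fin.sum_univ_three] <;>
      linear_combination hab
  change -((nw F * Matrix.diagonal ![a, 1, b]) * X * (nw F * Matrix.diagonal ![a, 1, b])⁻¹).transpose = _
  rw [hN, hinv]
  ext i j
  simp only [Matrix.neg_apply, Matrix.transpose_apply, Matrix.mul_apply, Fin.sum_univ_three]
  fin_cases i <;> fin_cases j <;> simp <;> grind

/-- The eigenvalues of `h` in terms of a square root `s` of `t₁` and its inverse `u`. -/
def hEigenvalue {F : Type*} [Field F] (s u : F) : Fin 8 → F :=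
  ![1, -1, -s ^ 2, -u ^ 2, s, -s, u, -u]

theorem hEigenvalue_injective {F : Type*} [Field F] {s u : F} (hsu : s * u = 1)
    (h2 : (2 : F) ≠ 0) (h4 : s ^ 4 ≠ 1) (h6 : s ^ 6 ≠ 1) :
    Function.Injective (hEigenvalue s u) := by
  intro i j hij
  fin_cases i <;> fin_cases j <;> simp [hEigenvalue] at hij ⊢ <;> grind

/-- Eigenvectors of `h` for the eigenvalues `hEigenvalue s u`. -/
def hEigenvector {F : Type*} [Field F] (s u : F) : Fin 8 → Matrix (Fin 3) (Fin 3) F :=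
  ![!![1, 0, 0; 0, -1, 0; 0, 0, 0],
    !![1, 0, 0; 0, 1, 0; 0, 0, -2],
    !![0, 1, 0; 0, 0, 0; 0, 0, 0],
    !![0, 0, 0; 1, 0, 0; 0, 0, 0],
    !![0, 0, 1; 0, 0, 0; 0, s ^ 3, 0],
    !![0, 0, 1; 0, 0, 0; 0, -s ^ 3, 0],
    !![0, 0, 0; 0, 0, u ^ 3; 1, 0, 0],
    !![0, 0, 0; 0, 0, -u ^ 3; 1, 0, 0]]

theorem hEigenvector_mem {F : Type*} [Field F] (s u : F) (i : Fin 8) :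
    hEigenvector s u i ∈ sl3 F := by
  fin_cases i <;>
    simp [hEigenvector, sl3, LinearMap.mem_ker, Matrix.trace, Fin.sum_univ_three]
  ring

theorem hEigenvector_ne_zero {F : Type*} [Field F] (s u : F) (i : Fin 8) :
    hEigenvector s u i ≠ 0 := by
  intro h
  have hentry (j k : Fin 3) : hEigenvector s u i j k = 0 := by rw [h, Matrix.zero_apply]
  have h00 := hentry 0 0
  have h01 := hentry 0 1
  have h10 := hentry 1 0
  have h02 := hentry 0 2
  have h20 := hentry 2 0
  fin_cases i <;> simp [hEigenvector] at h00 h01 h10 h02 h20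

theorem hFull_hEigenvector {F : Type*} [Field F] {s u : F} (hsu : s * u = 1) (i : Fin 8) :
    hFull F (s ^ 2) 1 (u ^ 2) (hEigenvector s u i) = hEigenvalue s u i • hEigenvector s u i := by
  rw [hFull_apply (by rw [← mul_pow, hsu, one_pow])]
  ext j k
  fin_cases i <;> fin_cases j <;> fin_cases k <;> simp [hEigenvector, hEigenvalue] <;> grind

/-- (The `SL₃(q)` case.) If `char F = p ≥ 5`, `q` is a power of `p`, and `t₁ ∈ F^×` has
multiplicative order `q - 1`, then with `t = diag(t₁, 1, t₁⁻¹)` the endomorphism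
`h : X ↦ -((n_w t) X (n_w t)⁻¹)ᵀ` of `sl₃(F)` has simple spectrum, i.e. eight pairwise
distinct eigenvalues. -/
theorem stmt_7 (F : Type*) [Field F] [IsAlgClosed F]
    (p : ℕ) [CharP F p] (hp : p.Prime) (hp5 : 5 ≤ p)
    (q : ℕ) (m : ℕ) (hm : 0 < m) (hq : q = p ^ m)
    (t₁ : F) (ht₁ : orderOf t₁ = q - 1)
    (hinv : ∀ X ∈ sl3 F, hFull F t₁ 1 t₁⁻¹ X ∈ sl3 F) :
    HasSimpleSpectrum ((hFull F t₁ 1 t₁⁻¹).restrict hinv) := by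
  obtain ⟨s, rfl⟩ := IsAlgClosed.exists_pow_nat_eq t₁ two_pos
  have hq5 : 5 ≤ q := hq ▸ hp5.trans (Nat.le_self_pow hm.ne' p)
  have hpow (n : ℕ) (h0 : n ≠ 0) (h4 : n < 4) : (s ^ 2) ^ n ≠ 1 := fun h => by
    have := Nat.le_of_dvd (by omega) (orderOf_dvd_of_pow_eq_one h)
    omega
  have hs : s ≠ 0 := by
    rintro rfl
    have : orderOf ((0 : F) ^ 2) = 0 := by simp
    omega
  have h2 : (2 : F) ≠ 0 := fun h => by
    have := Nat.le_of_dvd two_pos ((CharP.cast_eq_zero_iff F p 2).1 (by exact_mod_cast h))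
    omega
  have hsu : s * s⁻¹ = 1 := mul_inv_cancel₀ hs
  have hinj : Function.Injective (hEigenvalue s s⁻¹) := hEigenvalue_injective hsu h2
    (by simpa [← pow_mul] using hpow 2 (by norm_num) (by norm_num))
    (by simpa [← pow_mul] using hpow 3 (by norm_num) (by norm_num))
  refine HasSimpleSpectrum.of_injective hinj
    (v := fun i => ⟨hEigenvector s s⁻¹ i, hEigenvector_mem s s⁻¹ i⟩)
    (fun i => ⟨Module.End.mem_eigenspace_iff.2 (Subtype.ext ?_), fun h =>
      hEigenvector_ne_zero s s⁻¹ i (congrArg Subtype.val h)⟩)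
    (by rw [finrank_sl3, Fintype.card_fin])
  simpa using hFull_hEigenvector hsu i
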